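/- Let G be a finite group. Let Cos_U(G) be the set of double coset digraphs Cos(G,K,S) with 1 < K ≤ G, K ∩ S = ∅, S = KSK, and K maximal with S = KSK (i.e., for every subgroup L with K < L ≤ G one has LSL ≠ S), and let Reducible(G) be the set of reducible Cayley digraphs of G. Then the map γ_U : Cos_U(G) → Reducible(G) defined by γ_U(Cos(G,K,S)) = Cay(G,S) is a bijection. -/

import Mathlib

open scoped Pointwise

namespace DCG

/-- An isomorphism of digraphs: a bijection of vertex sets mapping arcs to arcs and
non-arcs to non-arcs. -/
structure Iso {V W : Type*} (Γ₁ : Digraph V) (Γ₂ : Digraph W) extends V ≃ W where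
  adj_iff : ∀ u v : V, Γ₂.Adj (toEquiv u) (toEquiv v) ↔ Γ₁.Adj u v

/-- The wreath product of two digraphs. -/
def wr {V₁ V₂ : Type*} (Γ₁ : Digraph V₁) (Γ₂ : Digraph V₂) : Digraph (V₁ × V₂) where
  Adj p q := Γ₁.Adj p.1 q.1 ∨ (p.1 = q.1 ∧ Γ₂.Adj p.2 q.2)

/-- The automorphism group of a digraph, as a subgroup of the symmetric group on the
vertices. -/
def Aut {V : Type*} (Γ : Digraph V) : Subgroup (Equiv.Perm V) where
  carrier := {e | ∀ u v : V, Γ.Adj (e u) (e v) ↔ Γ.Adj u v}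
  one_mem' := by intro u v; rfl
  mul_mem' := by
    intro a b ha hb u v
    simpa [Equiv.Perm.mul_apply] using ((ha (b u) (b v)).trans (hb u v))
  inv_mem' := by
    intro a ha u v
    simpa using (ha (a⁻¹ u) (a⁻¹ v)).symm

/-- A subgroup of the symmetric group is transitive. -/
def IsTransitiveSub {V : Type*} (A : Subgroup (Equiv.Perm V)) : Prop :=
  ∀ u v : V, ∃ g ∈ A, (g : Equiv.Perm V) u = v

/-- A digraph is vertex-transitive when its automorphism group is transitive. -/
def IsVertexTransitive {V : Type*} (Γ : Digraph V) : Prop :=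
  IsTransitiveSub (Aut Γ)

/-- `ℬ` is a block system of the permutation group `A`: an `A`-invariant partition of the
point set. -/
def IsBlockSystemOf {V : Type*} (A : Subgroup (Equiv.Perm V)) (ℬ : Set (Set V)) : Prop :=
  Setoid.IsPartition ℬ ∧ ∀ g ∈ A, ∀ B ∈ ℬ, (g : Equiv.Perm V) '' B ∈ ℬ

/-- The block quotient digraph of `Γ` with respect to a set `ℬ` of sets of vertices. -/
def quotDgr {V : Type*} (Γ : Digraph V) (ℬ : Set (Set V)) : Digraph ℬ where
  Adj B B' := B ≠ B' ∧ ∃ x ∈ (B : Set V), ∃ y ∈ (B' : Set V), Γ.Adj x y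

/-- The subdigraph of `Γ` induced on a set `B` of vertices. -/
def induce {V : Type*} (Γ : Digraph V) (B : Set V) : Digraph B where
  Adj x y := Γ.Adj (x : V) (y : V)

/-- The double coset digraph `Cos(G,H,S)`. -/
def cos (G : Type*) [Group G] (H : Subgroup G) (S : Set G) : Digraph (G ⧸ H) where
  Adj a b := ∃ g s : G, s ∈ S ∧ a = QuotientGroup.mk g ∧ b = QuotientGroup.mk (g * s)

/-- The Cayley digraph `Cay(G,S)`. -/
def cay (G : Type*) [Group G] (S : Set G) : Digraph G where
  Adj a b := ∃ s ∈ S, b = a * s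

/-- The digraph on `n` vertices with no arcs. -/
def empt (n : ℕ) : Digraph (Fin n) where
  Adj _ _ := False

/-- The wreath product of two permutation groups, in its imprimitive action. -/
def permWr {X Y : Type*} (A : Subgroup (Equiv.Perm X)) (B : Subgroup (Equiv.Perm Y)) :
    Subgroup (Equiv.Perm (X × Y)) where
  carrier := {e | ∃ g ∈ A, ∃ h : X → Equiv.Perm Y, (∀ x, h x ∈ B) ∧
    ∀ p : X × Y, e p = (g p.1, h p.1 p.2)}
  one_mem' := ⟨1, A.one_mem, fun _ => 1, fun _ => B.one_mem, fun _ => rfl⟩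
  mul_mem' := by
    rintro a b ⟨g₁, hg₁, h₁, hh₁, he₁⟩ ⟨g₂, hg₂, h₂, hh₂, he₂⟩
    refine ⟨g₁ * g₂, A.mul_mem hg₁ hg₂, fun x => h₁ (g₂ x) * h₂ x,
      fun x => B.mul_mem (hh₁ _) (hh₂ _), fun p => ?_⟩
    simp [Equiv.Perm.mul_apply, he₁, he₂]
  inv_mem' := by
    rintro a ⟨g, hg, h, hh, he⟩
    refine ⟨g⁻¹, A.inv_mem hg, fun x => (h (g⁻¹ x))⁻¹,
      fun x => B.inv_mem (hh _), fun p => ?_⟩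
    have key : a (g⁻¹ p.1, (h (g⁻¹ p.1))⁻¹ p.2) = p := by
      rw [he]
      simp [Equiv.Perm.mul_apply]
    calc a⁻¹ p = a⁻¹ (a (g⁻¹ p.1, (h (g⁻¹ p.1))⁻¹ p.2)) := by rw [key]
    _ = (g⁻¹ p.1, (h (g⁻¹ p.1))⁻¹ p.2) := by simp

/-- The induced action of a permutation group `A` on a system `ℬ` of sets of points,
as a subgroup of the symmetric group on `ℬ`. -/
def inducedOn {X : Type*} (A : Subgroup (Equiv.Perm X)) (ℬ : Set (Set X)) :
    Subgroup (Equiv.Perm ℬ) where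
  carrier := {σ | ∃ g ∈ A, ∀ B : ℬ, ((σ B : Set X)) = (g : Equiv.Perm X) '' (B : Set X)}
  one_mem' := ⟨1, A.one_mem, by simp⟩
  mul_mem' := by
    rintro a b ⟨g₁, hg₁, h₁⟩ ⟨g₂, hg₂, h₂⟩
    refine ⟨g₁ * g₂, A.mul_mem hg₁ hg₂, fun B => ?_⟩
    have : ((a * b) B : Set X) = (a (b B) : Set X) := rfl
    rw [this, h₁, h₂]
    ext x
    simp [Equiv.Perm.mul_apply, Set.image_image]
  inv_mem' := by
    rintro a ⟨g, hg, h⟩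
    refine ⟨g⁻¹, A.inv_mem hg, fun B => ?_⟩
    have hb : ((a (a⁻¹ B)) : Set X) = (g : Equiv.Perm X) '' ((a⁻¹ B : ℬ) : Set X) := h _
    have hab : a (a⁻¹ B) = B := by simp
    rw [hab] at hb
    rw [hb]
    ext x
    simp

/-- A digraph is complete if every ordered pair of distinct vertices is an arc. -/
def IsComplete {V : Type*} (Γ : Digraph V) : Prop := ∀ u v : V, u ≠ v → Γ.Adj u v

/-- A digraph has no arcs. -/
def HasNoArcs {V : Type*} (Γ : Digraph V) : Prop := ∀ u v : V, ¬ Γ.Adj u v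

/-- A digraph is reducible if two distinct vertices have the same out-neighbours and the
same in-neighbours. -/
def Reducible {V : Type*} (Γ : Digraph V) : Prop :=
  ∃ u v : V, u ≠ v ∧ (∀ w, Γ.Adj u w ↔ Γ.Adj v w) ∧ (∀ w, Γ.Adj w u ↔ Γ.Adj w v)

/-- A regular subgroup of a symmetric group: transitive, and only the identity fixes a
point. -/
def IsRegularSub {X : Type*} [Nonempty X] (L : Subgroup (Equiv.Perm X)) : Prop :=
  IsTransitiveSub L ∧ ∀ g ∈ L, (∃ x : X, (g : Equiv.Perm X) x = x) → g = 1

/-- A block system for a multiplicative action: an invariant partition. -/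
def IsBlockSystemMul (G : Type*) [Group G] {X : Type*} [MulAction G X]
    (ℬ : Set (Set X)) : Prop :=
  Setoid.IsPartition ℬ ∧ ∀ (g : G), ∀ B ∈ ℬ, g • B ∈ ℬ

/-- `Γ` is isomorphic to a nontrivial wreath product of two vertex-transitive digraphs,
each with at least two vertices. -/
def IsNontrivialWreathProduct {V : Type*} (Γ : Digraph V) : Prop :=
  ∃ (V₁ V₂ : Type) (Γ₁ : Digraph V₁) (Γ₂ : Digraph V₂),
    IsVertexTransitive Γ₁ ∧ IsVertexTransitive Γ₂ ∧
    2 ≤ Nat.card V₁ ∧ 2 ≤ Nat.card V₂ ∧ Nonempty (Iso Γ (wr Γ₁ Γ₂))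

/-- The block quotient of a digraph on `G` by the partition of `G` into left cosets
of `H`, realized on the vertex set `G ⧸ H`. -/
def cosetQuot (G : Type*) [Group G] (H : Subgroup G) (Γ : Digraph G) : Digraph (G ⧸ H) where
  Adj a b := a ≠ b ∧ ∃ x y : G, (QuotientGroup.mk x : G ⧸ H) = a ∧
    (QuotientGroup.mk y : G ⧸ H) = b ∧ Γ.Adj x y

/-- The elements of `G` that stabilize `S` under both left and right multiplication. -/
def biStabilizer {G : Type*} [Group G] (S : Set G) : Subgroup G :=
  MulAction.stabilizer G S ⊓ (MulAction.stabilizer Gᵐᵒᵖ S).unop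

theorem mem_biStabilizer {G : Type*} [Group G] {S : Set G} {g : G} :
    g ∈ biStabilizer S ↔ (∀ s, g * s ∈ S ↔ s ∈ S) ∧ ∀ s, s * g ∈ S ↔ s ∈ S := by
  rw [biStabilizer, Subgroup.mem_inf, Subgroup.mem_unop, MulAction.mem_stabilizer_set,
    MulAction.mem_stabilizer_set]
  rfl

theorem mul_mul_eq_self_iff_le_biStabilizer {G : Type*} [Group G] {L : Subgroup G} {S : Set G} :
    (L : Set G) * S * (L : Set G) = S ↔ L ≤ biStabilizer S := by
  constructor
  · intro h
    have hl : ∀ l ∈ L, ∀ s ∈ S, l * s ∈ S := fun l hl s hs ↦ by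
      rw [← h]
      exact ⟨l * s, ⟨l, hl, s, hs, rfl⟩, 1, L.one_mem, mul_one _⟩
    have hr : ∀ l ∈ L, ∀ s ∈ S, s * l ∈ S := fun l hl s hs ↦ by
      rw [← h]
      exact ⟨s, ⟨1, L.one_mem, s, hs, one_mul _⟩, l, hl, rfl⟩
    intro l hlL
    refine mem_biStabilizer.2 ⟨fun s ↦ ⟨fun hs ↦ ?_, hl l hlL s⟩,
      fun s ↦ ⟨fun hs ↦ ?_, hr l hlL s⟩⟩
    · simpa using hl l⁻¹ (L.inv_mem hlL) _ hs
    · simpa using hr l⁻¹ (L.inv_mem hlL) _ hs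
  · intro h
    ext x
    constructor
    · rintro ⟨_, ⟨l, hl, s, hs, rfl⟩, m, hm, rfl⟩
      exact ((mem_biStabilizer.1 (h hm)).2 _).2 (((mem_biStabilizer.1 (h hl)).1 _).2 hs)
    · exact fun hx ↦ ⟨x, ⟨1, L.one_mem, x, hx, one_mul _⟩, 1, L.one_mem, mul_one _⟩

/-- The largest subgroup `K` with `K * S * K = S` is the two-sided stabilizer of `S`. -/
theorem eq_biStabilizer_of_maximal {G : Type*} [Group G] {K : Subgroup G} {S : Set G}
    (h : (K : Set G) * S * (K : Set G) = S)
    (hmax : ∀ L : Subgroup G, K < L → (L : Set G) * S * (L : Set G) ≠ S) :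
    K = biStabilizer S := by
  by_contra hne
  exact hmax _ (lt_of_le_of_ne (mul_mul_eq_self_iff_le_biStabilizer.1 h) hne)
    (mul_mul_eq_self_iff_le_biStabilizer.2 le_rfl)

theorem cay_adj {G : Type*} [Group G] {S : Set G} {a b : G} :
    (cay G S).Adj a b ↔ a⁻¹ * b ∈ S := by
  constructor
  · rintro ⟨s, hs, rfl⟩
    simpa using hs
  · exact fun h ↦ ⟨_, h, by simp⟩

theorem cay_injective {G : Type*} [Group G] : Function.Injective (cay G) := by
  intro S₁ S₂ h
  ext s
  simpa [cay_adj] using iff_of_eq (congrArg (fun Γ : Digraph G ↦ Γ.Adj 1 s) h)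

theorem reducible_cay_iff {G : Type*} [Group G] {S : Set G} :
    Reducible (cay G S) ↔ ⊥ < biStabilizer S := by
  rw [bot_lt_iff_ne_bot, ← Subgroup.nontrivial_iff_ne_bot, Subgroup.nontrivial_iff_exists_ne_one]
  constructor
  · rintro ⟨u, v, huv, hout, hin⟩
    refine ⟨v⁻¹ * u, mem_biStabilizer.2 ⟨fun s ↦ ?_, fun s ↦ ?_⟩, ?_⟩
    · simpa [cay_adj, mul_assoc] using (hout (u * s)).symm
    · simpa [cay_adj, mul_assoc] using hin (v * s⁻¹)
    · exact fun h ↦ huv (inv_mul_eq_one.1 h).symm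
  · rintro ⟨k, hk, hk1⟩
    obtain ⟨hl, hr⟩ := mem_biStabilizer.1 hk
    refine ⟨k, 1, hk1, fun w ↦ ?_, fun w ↦ ?_⟩
    · simpa [cay_adj] using (hl (k⁻¹ * w)).symm
    · simpa [cay_adj] using hr w⁻¹

theorem disjoint_biStabilizer {G : Type*} [Group G] {S : Set G} (h1 : (1 : G) ∉ S) :
    (biStabilizer S : Set G) ∩ S = ∅ := by
  refine Set.eq_empty_of_forall_notMem fun k hk ↦ h1 ?_
  simpa [hk.2] using (mem_biStabilizer.1 hk.1).1 1

/-- The map `γ_U : Cos_U(G) → Reducible(G)`, `γ_U(Cos(G,K,S)) = Cay(G,S)`,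
is a bijection: it is well defined, onto, and injective on the parameters `(K,S)`. -/
theorem statement_11 {G : Type*} [Group G] [Finite G] :
    -- γ_U is well defined: each element of Cos_U(G) yields a reducible Cayley digraph
    (∀ (K : Subgroup G) (S : Set G), ⊥ < K → (K : Set G) ∩ S = ∅ →
      (K : Set G) * S * (K : Set G) = S →
      (∀ L : Subgroup G, K < L → (L : Set G) * S * (L : Set G) ≠ S) →
      (1 : G) ∉ S ∧ Reducible (cay G S)) ∧
    -- γ_U is onto
    (∀ S : Set G, (1 : G) ∉ S → Reducible (cay G S) →
      ∃ K : Subgroup G, ⊥ < K ∧ (K : Set G) ∩ S = ∅ ∧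
        (K : Set G) * S * (K : Set G) = S ∧
        ∀ L : Subgroup G, K < L → (L : Set G) * S * (L : Set G) ≠ S) ∧
    -- γ_U is injective
    (∀ (K₁ K₂ : Subgroup G) (S₁ S₂ : Set G),
      ⊥ < K₁ → (K₁ : Set G) ∩ S₁ = ∅ → (K₁ : Set G) * S₁ * (K₁ : Set G) = S₁ →
      (∀ L : Subgroup G, K₁ < L → (L : Set G) * S₁ * (L : Set G) ≠ S₁) →
      ⊥ < K₂ → (K₂ : Set G) ∩ S₂ = ∅ → (K₂ : Set G) * S₂ * (K₂ : Set G) = S₂ →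
      (∀ L : Subgroup G, K₂ < L → (L : Set G) * S₂ * (L : Set G) ≠ S₂) →
      cay G S₁ = cay G S₂ → K₁ = K₂ ∧ S₁ = S₂) := by
  refine ⟨fun K S hK hKS h _ ↦ ⟨fun h1 ↦ ?_, ?_⟩, fun S h1 hred ↦ ?_, ?_⟩
  · exact hKS.subset ⟨K.one_mem, h1⟩
  · exact reducible_cay_iff.2 (hK.trans_le (mul_mul_eq_self_iff_le_biStabilizer.1 h))
  · exact ⟨biStabilizer S, reducible_cay_iff.1 hred, disjoint_biStabilizer h1,
      mul_mul_eq_self_iff_le_biStabilizer.2 le_rfl,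
      fun L hL h ↦ hL.not_ge (mul_mul_eq_self_iff_le_biStabilizer.1 h)⟩
  · intro K₁ K₂ S₁ S₂ _ _ h₁ hmax₁ _ _ h₂ hmax₂ hcay
    obtain rfl := cay_injective hcay
    exact ⟨(eq_biStabilizer_of_maximal h₁ hmax₁).trans
      (eq_biStabilizer_of_maximal h₂ hmax₂).symm, rfl⟩

end DCG
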